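/- Let 𝒞 be a Cartan scheme with a root system ℛ of type 𝒞 such that Δ^Z is finite for every Z ∈ 𝒳. Fix X ∈ 𝒳, let M := |Δ^X_+|, and let < be a total order on Δ^X_+. Then the following are equivalent: (1) there exist Y ∈ 𝒳 and a word (i_1,…,i_M) based at X with endpoint Y which is a reduced expression of its morphism w (so ℓ(w) = M, i.e., w has maximal length in Hom(𝒲,X)) such that Δ^X_+ = {β_1,…,β_M} and β_1 < β_2 < ⋯ < β_M; (2) < is strongly convex: whenever k ≥ 2 and γ_1 ≤ γ_2 ≤ ⋯ ≤ γ_k are elements of Δ^X_+ (repetitions allowed) with γ := γ_1 + ⋯ + γ_k ∈ Δ^X_+, then γ_1 < γ < γ_k; (3) < is convex: whenever α < β in Δ^X_+ and α + β ∈ Δ^X_+, then α < α + β < β. -/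

import Mathlib

noncomputable section

open scoped BigOperators

namespace WeylGpd

/-- A Cartan scheme: objects `X`, reflection maps `r_i`, and generalized Cartan matrices `A^X`
with `a^{r_i(X)}_{ij} = a^X_{ij}`. -/
structure CartanScheme (n : ℕ) where
  X : Type
  nonempty : Nonempty X
  r : Fin n → X → X
  r_invol : ∀ i x, r i (r i x) = x
  A : X → Matrix (Fin n) (Fin n) ℤ
  A_diag : ∀ x i, A x i i = 2
  A_nonpos : ∀ x i j, i ≠ j → A x i j ≤ 0
  A_zero_iff : ∀ x i j, A x i j = 0 ↔ A x j i = 0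
  A_r : ∀ x i j, A (r i x) i j = A x i j

variable {n : ℕ}

/-- The standard basis vector `α_i` of `ℤ^I`. -/
def alphav (n : ℕ) (i : Fin n) : Fin n → ℤ := Pi.single i 1

/-- The vectors with all coordinates nonnegative. -/
def Epos (n : ℕ) : Set (Fin n → ℤ) := {v | ∀ i, 0 ≤ v i}

/-- The reflection `s_i^X`, `s_i^X(α_j) = α_j − a^X_{ij} α_i`, extended linearly. -/
def sMap (C : CartanScheme n) (i : Fin n) (x : C.X) (v : Fin n → ℤ) : Fin n → ℤ :=
  v - (∑ j, C.A x i j * v j) • alphav n i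

/-- The endpoint `X_{m+1}` of a word `(i_1, …, i_m)` based at `x`. -/
def wordEnd (C : CartanScheme n) : C.X → List (Fin n) → C.X
  | x, [] => x
  | x, (i :: w) => wordEnd C (C.r i x) w

/-- The automorphism `s_{i_1}^{X_1} ∘ ⋯ ∘ s_{i_m}^{X_m}` of a word based at `x`. -/
def wordMap (C : CartanScheme n) : C.X → List (Fin n) → (Fin n → ℤ) → (Fin n → ℤ)
  | _, [] => id
  | x, (i :: w) => sMap C i x ∘ wordMap C (C.r i x) w

/-- The roots `β_j = s_{i_1} ⋯ s_{i_{j-1}} (α_{i_j})` of a word based at `x` (0-indexed). -/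
def wordRoot (C : CartanScheme n) (x : C.X) (w : List (Fin n)) (j : Fin w.length) :
    Fin n → ℤ :=
  wordMap C x (w.take j) (alphav n (w.get j))

/-- A root system of type `𝒞`. -/
structure RootSystem (C : CartanScheme n) where
  Δ : C.X → Set (Fin n → ℤ)
  pos_neg : ∀ x, Δ x = (Δ x ∩ Epos n) ∪ (-(Δ x ∩ Epos n))
  simple : ∀ x i, Δ x ∩ {v | ∃ m : ℤ, v = m • alphav n i} = {alphav n i, -alphav n i}
  s_invariant : ∀ x i, sMap C i x '' Δ x = Δ (C.r i x)
  rank_two_finite : ∀ x i j, i ≠ j →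
    (Δ x ∩ {v | ∃ a b : ℕ, v = (a : ℤ) • alphav n i + (b : ℤ) • alphav n j}).Finite
  rank_two : ∀ x i j, i ≠ j →
    ((C.r i) ∘ (C.r j))^[(Δ x ∩
      {v | ∃ a b : ℕ, v = (a : ℤ) • alphav n i + (b : ℤ) • alphav n j}).ncard] x = x

/-- Positive roots at `x`. -/
def RootSystem.pos {C : CartanScheme n} (R : RootSystem C) (x : C.X) : Set (Fin n → ℤ) :=
  R.Δ x ∩ Epos n

/-- `(φ, (y, x))` is realized by the word `w` based at `x` with endpoint `y`. -/
def IsWord (C : CartanScheme n) (x y : C.X) (φ : (Fin n → ℤ) → (Fin n → ℤ))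
    (w : List (Fin n)) : Prop :=
  wordEnd C x w = y ∧ wordMap C x w = φ

/-- `(φ, (y, x))` is a morphism of the Weyl groupoid, i.e. `Hom(y, x) ∋ φ`. -/
def IsHom (C : CartanScheme n) (x y : C.X) (φ : (Fin n → ℤ) → (Fin n → ℤ)) : Prop :=
  ∃ w : List (Fin n), IsWord C x y φ w

/-- The length `ℓ(w)` of a morphism. -/
def hlen (C : CartanScheme n) (x y : C.X) (φ : (Fin n → ℤ) → (Fin n → ℤ)) : ℕ :=
  sInf {m | ∃ w : List (Fin n), w.length = m ∧ IsWord C x y φ w}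

/-- `w` is a reduced expression of the morphism `(φ, (y, x))`. -/
def IsReduced (C : CartanScheme n) (x y : C.X) (φ : (Fin n → ℤ) → (Fin n → ℤ))
    (w : List (Fin n)) : Prop :=
  IsWord C x y φ w ∧ w.length = hlen C x y φ

/-- `R_w = {α ∈ Δ^X_+ : w^{-1}(α) ∈ Δ^Y_-}`, phrased as `α = w(δ)` for a negative root `δ`. -/
def Rset (C : CartanScheme n) (R : RootSystem C) (x y : C.X)
    (φ : (Fin n → ℤ) → (Fin n → ℤ)) : Set (Fin n → ℤ) :=
  {α | α ∈ R.pos x ∧ ∃ γ ∈ R.pos y, φ (-γ) = α}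

end WeylGpd

namespace WeylGpd

section Helpers

variable {n : ℕ} {C : CartanScheme n}

/-! ### Rank two -/

/-- Coprime positive integers `a`, `b` have a Farey parent `(c, d)`. -/
lemma exists_farey_parent {a b : ℤ} (ha : 1 ≤ a) (hb : 1 ≤ b) (hab : IsCoprime a b) :
    ∃ c d : ℤ, 0 ≤ c ∧ c ≤ a ∧ 0 ≤ d ∧ d ≤ b ∧ a * d - b * c = 1 := by
  obtain ⟨r, s, hrs⟩ := hab
  have h0 : 0 ≤ (-s) % a := Int.emod_nonneg _ (by omega)
  have h1 : (-s) % a < a := Int.emod_lt_of_pos _ (by omega)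
  have h2 := Int.emod_add_mul_ediv (-s) a
  set c := (-s) % a
  set k := (-s) / a
  have hd : a * (r - b * k) - b * c = 1 := by linear_combination hrs - b * h2
  refine ⟨c, r - b * k, h0, h1.le, ?_, ?_, hd⟩
  · by_contra! h
    nlinarith [mul_nonneg (by omega : (0 : ℤ) ≤ b) h0]
  · by_contra! h
    nlinarith [mul_le_mul_of_nonneg_left (by omega : c ≤ a - 1) (by omega : (0 : ℤ) ≤ b)]

/-- The data available for the roots of a finite rank two root system, in coordinates:
signs of the coordinates, and the decomposition of the first quadrant into unimodular
cells whose interiors contain no roots. -/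
structure RankTwoFan (S : ℤ → ℤ → Prop) : Prop where
  left : S 1 0
  right : S 0 1
  sign : ∀ a b, S a b → (0 ≤ a ∧ 0 ≤ b) ∨ (a ≤ 0 ∧ b ≤ 0)
  coprime : ∀ a b, S a b → IsCoprime a b
  cell : ∀ c d, 0 ≤ c → 0 ≤ d → (c ≠ 0 ∨ d ≠ 0) → ∃ p₁ p₂ q₁ q₂ x y : ℤ,
    S p₁ p₂ ∧ 0 ≤ p₁ ∧ 0 ≤ p₂ ∧ S q₁ q₂ ∧ 0 ≤ x ∧ 0 ≤ y ∧
    c = x * p₁ + y * q₁ ∧ d = x * p₂ + y * q₂ ∧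
    ∀ e f, S e f → ∃ z t : ℤ, z * t ≤ 0 ∧ e = z * p₁ + t * q₁ ∧ f = z * p₂ + t * q₂

lemma RankTwoFan.mem_of_farey_parent {S : ℤ → ℤ → Prop} (hS : RankTwoFan S) {a b c d : ℤ}
    (hab : S a b) (ha : 1 ≤ a) (hb : 1 ≤ b) (hc : 0 ≤ c) (hd : 0 ≤ d) (hca : c ≤ a)
    (hdb : d ≤ b) (hdet : IsUnit (a * d - b * c)) : S c d := by
  have hne : c ≠ 0 ∨ d ≠ 0 := by
    by_contra! h
    rw [h.1, h.2] at hdet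
    simp at hdet
  obtain ⟨p₁, p₂, q₁, q₂, x, y, hp, hp1, hp2, hq, hx, hy, rfl, rfl, H⟩ := hS.cell c d hc hd hne
  obtain ⟨z, t, hzt, rfl, rfl⟩ := H a b hab
  obtain ⟨z₁, t₁, hzt1, e1, f1⟩ := H 1 0 hS.left
  obtain ⟨z₂, t₂, hzt2, e2, f2⟩ := H 0 1 hS.right
  have hfac : (z * p₁ + t * q₁) * (x * p₂ + y * q₂) - (z * p₂ + t * q₂) * (x * p₁ + y * q₁)
      = (z * y - t * x) * (p₁ * q₂ - p₂ * q₁) := by ring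
  rw [hfac] at hdet
  have hu := isUnit_of_mul_isUnit_left hdet
  have hD := isUnit_of_mul_isUnit_right hdet
  -- a nonpositive `q` cannot contribute
  have key : q₁ ≤ 0 → q₂ ≤ 0 → y = 0 := by
    intro hq1 hq2
    have t1 : t₁ ≤ 0 := by
      by_contra! h
      have : z₁ ≤ 0 := by nlinarith
      nlinarith [mul_nonneg_of_nonpos_of_nonpos (by linarith : -p₁ ≤ 0) this]
    have t2 : t₂ ≤ 0 := by
      by_contra! h
      have : z₂ ≤ 0 := by nlinarith
      nlinarith [mul_nonneg_of_nonpos_of_nonpos (by linarith : -p₂ ≤ 0) this]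
    have hy' : y = (x * p₁ + y * q₁) * t₁ + (x * p₂ + y * q₂) * t₂ := by
      have h3 : (p₁ * q₂ - p₂ * q₁) * (y - ((x * p₁ + y * q₁) * t₁ + (x * p₂ + y * q₂) * t₂))
          = 0 := by
        linear_combination p₁ * (x * p₂ + y * q₂) * f2 - p₂ * (x * p₁ + y * q₁) * e1
          + p₁ * (x * p₁ + y * q₁) * f1 - p₂ * (x * p₂ + y * q₂) * e2
      rcases mul_eq_zero.mp h3 with h | h
      · rw [h] at hD; simp at hD
      · linarith
    nlinarith [mul_nonneg hc (by linarith : 0 ≤ -t₁), mul_nonneg hd (by linarith : 0 ≤ -t₂)]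
  have hprod : (z * y) * (t * x) ≤ 0 := by
    nlinarith [mul_nonneg hx hy]
  have hcase : (t * x = 0 ∧ IsUnit (z * y)) ∨ (z * y = 0 ∧ IsUnit (t * x)) := by
    generalize z * y = A at *
    generalize t * x = B at *
    rw [Int.isUnit_iff] at hu
    simp only [Int.isUnit_iff]
    rcases lt_trichotomy A 0 with hA | hA | hA
    · have : 0 ≤ B := by nlinarith
      omega
    · omega
    · have : B ≤ 0 := by nlinarith
      omega
  rcases hcase with ⟨h0, h1⟩ | ⟨h0, h1⟩
  · have hy1 : y = 1 := by
      have := isUnit_of_mul_isUnit_right h1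
      rw [Int.isUnit_iff] at this; omega
    have hz := isUnit_of_mul_isUnit_left h1
    rcases eq_or_ne x 0 with rfl | hx0
    · subst hy1; simpa using hq
    · have ht : t = 0 := by simpa [hx0] using h0
      subst ht hy1
      exfalso
      rcases Int.isUnit_iff.mp hz with rfl | rfl
      · have hx1 : 0 ≤ x - 1 := by omega
        have := key (by linarith [mul_nonneg hx1 hp1]) (by linarith [mul_nonneg hx1 hp2])
        omega
      · linarith
  · have hx1 : x = 1 := by
      have := isUnit_of_mul_isUnit_right h1
      rw [Int.isUnit_iff] at this; omega
    have ht := isUnit_of_mul_isUnit_left h1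
    rcases eq_or_ne y 0 with rfl | hy0
    · subst hx1; simpa using hp
    · have hz : z = 0 := by simpa [hy0] using h0
      subst hz hx1
      exfalso
      rcases Int.isUnit_iff.mp ht with rfl | rfl
      · have hy1 : 0 ≤ y - 1 := by omega
        have hp10 : p₁ = 0 := by linarith [mul_nonneg hy1 (by linarith : 0 ≤ q₁)]
        have hp20 : p₂ = 0 := by linarith [mul_nonneg hy1 (by linarith : 0 ≤ q₂)]
        rw [hp10, hp20] at hD
        simp at hD
      · exact hy0 (key (by linarith) (by linarith))

lemma RankTwoFan.exists_add {S : ℤ → ℤ → Prop} (hS : RankTwoFan S) {a b : ℤ}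
    (hab : S a b) (ha : 1 ≤ a) (hb : 1 ≤ b) :
    ∃ c d, S c d ∧ S (a - c) (b - d) ∧ 0 ≤ c ∧ c ≤ a ∧ 0 ≤ d ∧ d ≤ b := by
  obtain ⟨c, d, hc, hca, hd, hdb, h⟩ := exists_farey_parent ha hb (hS.coprime a b hab)
  refine ⟨c, d, hS.mem_of_farey_parent hab ha hb hc hd hca hdb (by rw [h]; exact isUnit_one),
    hS.mem_of_farey_parent hab ha hb (by omega) (by omega) (by omega) (by omega) ?_,
    hc, hca, hd, hdb⟩
  have : a * (b - d) - b * (a - c) = -1 := by linarith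
  rw [this]
  exact isUnit_one.neg

/-! ### Words as linear automorphisms -/

lemma alphav_apply (i l : Fin n) : alphav n i l = if l = i then 1 else 0 := by
  simp [alphav, Pi.single_apply]

lemma eq_sum_alphav (v : Fin n → ℤ) : v = ∑ i, v i • alphav n i := by
  ext l
  simp [Finset.sum_apply, alphav_apply]

lemma sMap_apply_of_ne {i l : Fin n} (h : l ≠ i) (x : C.X) (v : Fin n → ℤ) :
    sMap C i x v l = v l := by
  simp [sMap, alphav_apply, h]

lemma sum_A_alphav (i j : Fin n) (x : C.X) : ∑ l, C.A x i l * alphav n j l = C.A x i j := by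
  simp [alphav_apply]

lemma sMap_alphav_self (i : Fin n) (x : C.X) : sMap C i x (alphav n i) = -alphav n i := by
  rw [sMap, sum_A_alphav, C.A_diag, two_smul]
  abel

lemma sMap_r (i : Fin n) (x : C.X) (v : Fin n → ℤ) : sMap C i (C.r i x) v = sMap C i x v := by
  simp [sMap, C.A_r]

/-- The reflection `s_i^X` as a linear map. -/
def sLin (C : CartanScheme n) (i : Fin n) (x : C.X) : (Fin n → ℤ) →ₗ[ℤ] (Fin n → ℤ) where
  toFun := sMap C i x
  map_add' u v := by
    ext l
    simp only [sMap, Pi.add_apply, mul_add, Finset.sum_add_distrib, Pi.sub_apply, Pi.smul_apply,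
      smul_eq_mul]
    ring
  map_smul' c v := by
    ext l
    simp only [sMap, Pi.smul_apply, smul_eq_mul, mul_left_comm _ c, ← Finset.mul_sum,
      Pi.sub_apply, RingHom.id_apply]
    ring

lemma sLin_involutive (i : Fin n) (x : C.X) : Function.Involutive (sLin C i x) := by
  intro v
  have h : sLin C i x v = v - (∑ j, C.A x i j * v j) • alphav n i := rfl
  have h' : sLin C i x (alphav n i) = -alphav n i := sMap_alphav_self i x
  conv_lhs => rw [h, map_sub, map_smul, h', h]
  module

/-- The reflection `s_i^X` as a linear automorphism. -/
def sEquiv (C : CartanScheme n) (i : Fin n) (x : C.X) : (Fin n → ℤ) ≃ₗ[ℤ] (Fin n → ℤ) :=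
  LinearEquiv.ofInvolutive (sLin C i x) (sLin_involutive i x)

@[simp] lemma sEquiv_apply (i : Fin n) (x : C.X) (v : Fin n → ℤ) :
    sEquiv C i x v = sMap C i x v := rfl

@[simp] lemma sEquiv_symm_apply (i : Fin n) (x : C.X) (v : Fin n → ℤ) :
    (sEquiv C i x).symm v = sMap C i x v := rfl

/-- The automorphism of a word as a linear automorphism. -/
def wordEquiv (C : CartanScheme n) : C.X → List (Fin n) → ((Fin n → ℤ) ≃ₗ[ℤ] (Fin n → ℤ))
  | _, [] => LinearEquiv.refl ℤ _
  | x, (i :: w) => (wordEquiv C (C.r i x) w).trans (sEquiv C i x)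

lemma coe_wordEquiv (x : C.X) (w : List (Fin n)) : ⇑(wordEquiv C x w) = wordMap C x w := by
  induction w generalizing x with
  | nil => rfl
  | cons i w ih =>
    ext v
    simp [wordEquiv, wordMap, ih]

lemma wordEnd_append (x : C.X) (w v : List (Fin n)) :
    wordEnd C x (w ++ v) = wordEnd C (wordEnd C x w) v := by
  induction w generalizing x with
  | nil => rfl
  | cons i w ih => simp [wordEnd, ih]

lemma wordEquiv_append (x : C.X) (w v : List (Fin n)) :
    wordEquiv C x (w ++ v) = (wordEquiv C (wordEnd C x w) v).trans (wordEquiv C x w) := by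
  induction w generalizing x with
  | nil => rfl
  | cons i w ih =>
    simp only [List.cons_append, wordEquiv, wordEnd, ih]
    rfl

lemma wordEnd_snoc (x : C.X) (w : List (Fin n)) (i : Fin n) :
    wordEnd C x (w ++ [i]) = C.r i (wordEnd C x w) := by
  rw [wordEnd_append]; rfl

lemma wordEquiv_snoc_apply (x : C.X) (w : List (Fin n)) (i : Fin n) (v : Fin n → ℤ) :
    wordEquiv C x (w ++ [i]) v = wordEquiv C x w (sMap C i (wordEnd C x w) v) := by
  rw [wordEquiv_append]; rfl

lemma wordEquiv_snoc_symm_apply (x : C.X) (w : List (Fin n)) (i : Fin n) (v : Fin n → ℤ) :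
    (wordEquiv C x (w ++ [i])).symm v =
      sMap C i (wordEnd C x w) ((wordEquiv C x w).symm v) := by
  rw [wordEquiv_append]; rfl

lemma wordEquiv_snoc_alphav (x : C.X) (w : List (Fin n)) (i : Fin n) :
    wordEquiv C x (w ++ [i]) (alphav n i) = -wordEquiv C x w (alphav n i) := by
  rw [wordEquiv_snoc_apply, sMap_alphav_self, map_neg]

lemma wordEquiv_apply_of_notMem (x : C.X) {w : List (Fin n)} {l : Fin n} (h : l ∉ w)
    (v : Fin n → ℤ) : wordEquiv C x w v l = v l := by
  induction w generalizing x with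
  | nil => rfl
  | cons i w ih =>
    simp only [List.mem_cons, not_or] at h
    simp [wordEquiv, sMap_apply_of_ne h.1, ih _ h.2]

lemma wordEquiv_symm_apply_of_notMem (x : C.X) {w : List (Fin n)} {l : Fin n} (h : l ∉ w)
    (v : Fin n → ℤ) : (wordEquiv C x w).symm v l = v l := by
  conv_rhs => rw [← (wordEquiv C x w).apply_symm_apply v]
  rw [wordEquiv_apply_of_notMem x h]

/-! ### Positive roots -/

variable (R : RootSystem C)

namespace RootSystem

lemma pos_or_neg {x : C.X} {v : Fin n → ℤ} (h : v ∈ R.Δ x) : v ∈ R.pos x ∨ -v ∈ R.pos x := by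
  rw [R.pos_neg x] at h
  exact h

variable {R}

lemma neg_mem {x : C.X} {v : Fin n → ℤ} (h : v ∈ R.Δ x) : -v ∈ R.Δ x := by
  rcases R.pos_or_neg h with h' | h'
  · rw [R.pos_neg x]
    right
    rw [Set.mem_neg, neg_neg]
    exact h'
  · exact h'.1

lemma alphav_mem (x : C.X) (i : Fin n) : alphav n i ∈ R.pos x := by
  refine ⟨?_, fun l => ?_⟩
  · have : alphav n i ∈ ({alphav n i, -alphav n i} : Set (Fin n → ℤ)) := by simp
    rw [← R.simple x i] at this
    exact this.1
  · rw [alphav_apply]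
    split_ifs <;> simp

lemma eq_alphav_of_smul {x : C.X} {i : Fin n} {m : ℤ} (h : m • alphav n i ∈ R.Δ x) :
    m = 1 ∨ m = -1 := by
  have : m • alphav n i ∈ ({alphav n i, -alphav n i} : Set (Fin n → ℤ)) := by
    rw [← R.simple x i]
    exact ⟨h, m, rfl⟩
  rcases this with h | h
  · left
    simpa [alphav_apply] using congrFun h i
  · right
    simpa [alphav_apply] using congrFun h i

lemma exists_pos_apply {x : C.X} {v : Fin n → ℤ} (h : v ∈ R.pos x) {i : Fin n}
    (hi : v ≠ alphav n i) : ∃ l, l ≠ i ∧ 0 < v l := by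
  by_contra! H
  have hv : v = v i • alphav n i := by
    ext l
    by_cases hl : l = i
    · subst hl; simp [alphav_apply]
    · have := H l hl
      have := h.2 l
      simp [alphav_apply, hl]
      omega
  have hm := h.1
  rw [hv] at hm
  rcases eq_alphav_of_smul hm with h1 | h1
  · rw [h1, one_smul] at hv
    exact hi hv
  · have := h.2 i
    omega

lemma ne_zero [NeZero n] {x : C.X} {v : Fin n → ℤ} (h : v ∈ R.Δ x) : v ≠ 0 := by
  rintro rfl
  have := eq_alphav_of_smul (R := R) (x := x) (i := (0 : Fin n)) (m := 0) (by simpa using h)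
  omega

lemma neg_notMem_pos [NeZero n] {x : C.X} {v : Fin n → ℤ} (h : v ∈ R.pos x) : -v ∉ R.pos x := by
  intro h'
  refine ne_zero h.1 (funext fun l => ?_)
  have h1 := h.2 l
  have h2 := h'.2 l
  simp only [Pi.neg_apply, Pi.zero_apply] at *
  omega

lemma sMap_mem {x : C.X} {v : Fin n → ℤ} (i : Fin n) (h : v ∈ R.Δ x) :
    sMap C i x v ∈ R.Δ (C.r i x) := by
  rw [← R.s_invariant]
  exact ⟨v, h, rfl⟩

lemma sMap_mem_pos {x : C.X} {v : Fin n → ℤ} {i : Fin n} (h : v ∈ R.pos x)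
    (hi : v ≠ alphav n i) : sMap C i x v ∈ R.pos (C.r i x) := by
  rcases R.pos_or_neg (sMap_mem i h.1) with h' | h'
  · exact h'
  · obtain ⟨l, hl, hl'⟩ := exists_pos_apply h hi
    have := h'.2 l
    rw [Pi.neg_apply, sMap_apply_of_ne hl] at this
    omega

lemma wordEquiv_mem {x : C.X} (w : List (Fin n)) {v : Fin n → ℤ}
    (h : v ∈ R.Δ (wordEnd C x w)) : wordEquiv C x w v ∈ R.Δ x := by
  induction w generalizing x with
  | nil => exact h
  | cons i w ih =>
    have h1 := sMap_mem i (ih h)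
    rw [C.r_invol, sMap_r] at h1
    exact h1

lemma wordEquiv_symm_mem {x : C.X} (w : List (Fin n)) {v : Fin n → ℤ}
    (h : v ∈ R.Δ x) : (wordEquiv C x w).symm v ∈ R.Δ (wordEnd C x w) := by
  induction w generalizing x v with
  | nil => exact h
  | cons i w ih => exact ih (sMap_mem i h)

/-! ### Inversions -/

variable (R) in
/-- The positive roots at `x` which become negative at the endpoint of the word `w`. -/
def inversions (x : C.X) (w : List (Fin n)) : Set (Fin n → ℤ) :=
  {β | β ∈ R.pos x ∧ -(wordEquiv C x w).symm β ∈ R.pos (wordEnd C x w)}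

lemma inversions_nil [NeZero n] (x : C.X) : R.inversions x [] = ∅ := by
  ext β
  simp only [inversions, Set.mem_ofPred_eq, Set.mem_empty_iff_false, iff_false, not_and]
  exact neg_notMem_pos

lemma symm_mem_pos {x : C.X} {w : List (Fin n)} {β : Fin n → ℤ} (hβ : β ∈ R.pos x)
    (h : β ∉ R.inversions x w) : (wordEquiv C x w).symm β ∈ R.pos (wordEnd C x w) :=
  (R.pos_or_neg (wordEquiv_symm_mem w hβ.1)).resolve_right fun h' => h ⟨hβ, h'⟩

lemma notMem_inversions [NeZero n] {x : C.X} {w : List (Fin n)} {β : Fin n → ℤ}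
    (h : (wordEquiv C x w).symm β ∈ R.pos (wordEnd C x w)) : β ∉ R.inversions x w :=
  fun h' => neg_notMem_pos h h'.2

lemma inversions_snoc [NeZero n] {x : C.X} {w : List (Fin n)} {i : Fin n}
    (h : wordEquiv C x w (alphav n i) ∈ R.pos x) :
    R.inversions x (w ++ [i]) = insert (wordEquiv C x w (alphav n i)) (R.inversions x w) := by
  ext β
  rw [Set.mem_insert_iff]
  by_cases hβ : β = wordEquiv C x w (alphav n i)
  · simp only [hβ, true_or, iff_true]
    refine ⟨h, ?_⟩
    rw [wordEquiv_snoc_symm_apply, LinearEquiv.symm_apply_apply, sMap_alphav_self, neg_neg]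
    exact alphav_mem _ _
  · simp only [hβ, false_or]
    constructor
    · rintro ⟨h1, h2⟩
      by_contra h3
      have h4 := sMap_mem_pos (symm_mem_pos h1 h3) (i := i)
        (fun h5 => hβ (by rw [← h5, LinearEquiv.apply_symm_apply]))
      rw [wordEquiv_snoc_symm_apply, wordEnd_snoc] at h2
      exact neg_notMem_pos h4 h2
    · rintro ⟨h1, h2⟩
      refine ⟨h1, ?_⟩
      rw [wordEquiv_snoc_symm_apply, wordEnd_snoc]
      have h3 := sMap_mem_pos h2 (i := i) (fun h5 => by
        refine neg_notMem_pos h1 ?_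
        rw [← (wordEquiv C x w).apply_symm_apply β, ← map_neg, h5]
        exact h)
      have h4 : sMap C i (wordEnd C x w) (-(wordEquiv C x w).symm β)
          = -sMap C i (wordEnd C x w) ((wordEquiv C x w).symm β) :=
        map_neg (sEquiv C i (wordEnd C x w)) _
      rwa [h4] at h3

lemma notMem_inversions_of_apply [NeZero n] (x : C.X) (w : List (Fin n)) (i : Fin n) :
    wordEquiv C x w (alphav n i) ∉ R.inversions x w := by
  apply notMem_inversions
  rw [LinearEquiv.symm_apply_apply]
  exact alphav_mem _ _

lemma inversions_finite (hfin : ∀ z : C.X, (R.Δ z).Finite) (x : C.X) (w : List (Fin n)) :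
    (R.inversions x w).Finite :=
  (hfin x).subset fun _ h => h.1.1

lemma ncard_inversions_snoc [NeZero n] (hfin : ∀ z : C.X, (R.Δ z).Finite) {x : C.X}
    {w : List (Fin n)} {i : Fin n} (h : wordEquiv C x w (alphav n i) ∈ R.pos x) :
    (R.inversions x (w ++ [i])).ncard = (R.inversions x w).ncard + 1 := by
  rw [inversions_snoc h, Set.ncard_insert_of_notMem (notMem_inversions_of_apply x w i)
    (inversions_finite hfin x w)]

lemma inversions_snoc_snoc (x : C.X) (w : List (Fin n)) (i : Fin n) :
    R.inversions x (w ++ [i] ++ [i]) = R.inversions x w := by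
  have h (β : Fin n → ℤ) :
      (wordEquiv C x (w ++ [i] ++ [i])).symm β = (wordEquiv C x w).symm β := by
    rw [wordEquiv_snoc_symm_apply, wordEquiv_snoc_symm_apply, wordEnd_snoc, sMap_r]
    exact sLin_involutive i _ _
  simp only [inversions, h, wordEnd_snoc, C.r_invol]

lemma ncard_inversions_of_neg [NeZero n] (hfin : ∀ z : C.X, (R.Δ z).Finite) {x : C.X}
    {w : List (Fin n)} {i : Fin n} (h : -wordEquiv C x w (alphav n i) ∈ R.pos x) :
    (R.inversions x w).ncard = (R.inversions x (w ++ [i])).ncard + 1 := by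
  rw [← wordEquiv_snoc_alphav] at h
  rw [← ncard_inversions_snoc hfin h, inversions_snoc_snoc]

lemma ncard_inversions_le_length [NeZero n] (hfin : ∀ z : C.X, (R.Δ z).Finite) (x : C.X)
    (w : List (Fin n)) : (R.inversions x w).ncard ≤ w.length := by
  induction w using List.reverseRecOn with
  | nil => simp [inversions_nil]
  | append_singleton w i ih =>
    rw [List.length_append, List.length_singleton]
    rcases R.pos_or_neg (wordEquiv_mem w (alphav_mem _ i).1) with h | h
    · rw [ncard_inversions_snoc hfin h]
      omega
    · have := ncard_inversions_of_neg hfin h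
      omega

/-- A property of words cannot be preserved by arbitrarily many inversion-increasing
extensions. -/
lemma exists_not_extends [NeZero n] (hfin : ∀ z : C.X, (R.Δ z).Finite) (x : C.X)
    {P : List (Fin n) → Prop} (h0 : P []) :
    ∃ w, P w ∧ ∀ i, wordEquiv C x w (alphav n i) ∈ R.pos x → ¬ P (w ++ [i]) := by
  by_contra! H
  have key : ∀ k : ℕ, ∃ w, P w ∧ (R.inversions x w).ncard = k := by
    intro k
    induction k with
    | zero => exact ⟨[], h0, by simp [inversions_nil]⟩
    | succ k ih =>
      obtain ⟨w, hw, rfl⟩ := ih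
      obtain ⟨i, hi, hi'⟩ := H w hw
      exact ⟨w ++ [i], hi', ncard_inversions_snoc hfin hi⟩
  obtain ⟨w, -, hw⟩ := key ((R.Δ x).ncard + 1)
  have := Set.ncard_le_ncard (fun _ h => h.1.1 : R.inversions x w ⊆ R.Δ x) (hfin x)
  omega

/-- A longest word sends all simple roots to negative roots. -/
lemma exists_longest [NeZero n] (hfin : ∀ z : C.X, (R.Δ z).Finite) (x : C.X) :
    ∃ w : List (Fin n), ∀ i, -wordEquiv C x w (alphav n i) ∈ R.pos x := by
  obtain ⟨w, -, hw⟩ := exists_not_extends hfin x (P := fun _ => True) trivial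
  exact ⟨w, fun i => (R.pos_or_neg (wordEquiv_mem w (alphav_mem _ i).1)).resolve_left
    fun h => hw i h trivial⟩

lemma exists_word_of_mem_inversions {x : C.X} {w : List (Fin n)} {α : Fin n → ℤ} [NeZero n]
    (h : α ∈ R.inversions x w) :
    ∃ (v : List (Fin n)) (i : Fin n), wordEquiv C x v (alphav n i) = α := by
  induction w generalizing x α with
  | nil => simp [inversions_nil] at h
  | cons i w ih =>
    by_cases hα : α = alphav n i
    · exact ⟨[], i, hα.symm⟩
    · obtain ⟨v, j, hv⟩ := ih (x := C.r i x) (α := sMap C i x α)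
        ⟨sMap_mem_pos h.1 hα, h.2⟩
      refine ⟨i :: v, j, ?_⟩
      change sMap C i x (wordEquiv C (C.r i x) v (alphav n j)) = α
      rw [hv]
      exact sLin_involutive i x α

lemma apply_nonneg {x : C.X} {w : List (Fin n)} {v : Fin n → ℤ} (hv : ∀ l, 0 ≤ v l)
    (h : ∀ l, v l ≠ 0 → wordEquiv C x w (alphav n l) ∈ R.pos x) (l : Fin n) :
    0 ≤ wordEquiv C x w v l := by
  rw [eq_sum_alphav v, map_sum, Finset.sum_apply]
  refine Finset.sum_nonneg fun i _ => ?_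
  rw [map_smul, Pi.smul_apply, smul_eq_mul]
  rcases eq_or_ne (v i) 0 with h0 | h0
  · simp [h0]
  · exact mul_nonneg (hv i) ((h i h0).2 l)

lemma apply_nonpos {x : C.X} {w : List (Fin n)} {v : Fin n → ℤ} (hv : ∀ l, 0 ≤ v l)
    (h : ∀ l, v l ≠ 0 → -wordEquiv C x w (alphav n l) ∈ R.pos x) (l : Fin n) :
    wordEquiv C x w v l ≤ 0 := by
  rw [eq_sum_alphav v, map_sum, Finset.sum_apply]
  refine Finset.sum_nonpos fun i _ => ?_
  rw [map_smul, Pi.smul_apply, smul_eq_mul]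
  rcases eq_or_ne (v i) 0 with h0 | h0
  · simp [h0]
  · have := (h i h0).2 l
    rw [Pi.neg_apply] at this
    exact mul_nonpos_of_nonneg_of_nonpos (hv i) (by omega)

/-- All roots are real. -/
lemma exists_word_eq [NeZero n] (hfin : ∀ z : C.X, (R.Δ z).Finite) {x : C.X} {α : Fin n → ℤ}
    (h : α ∈ R.Δ x) : ∃ (w : List (Fin n)) (i : Fin n), wordEquiv C x w (alphav n i) = α := by
  have main : ∀ α ∈ R.pos x, ∃ (w : List (Fin n)) (i : Fin n),
      wordEquiv C x w (alphav n i) = α := by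
    intro α h
    obtain ⟨w, hw⟩ := exists_longest hfin x
    apply exists_word_of_mem_inversions (w := w)
    by_contra h'
    refine ne_zero h.1 (funext fun l => ?_)
    have h1 := apply_nonpos (symm_mem_pos h h').2 (fun i _ => hw i) l
    rw [LinearEquiv.apply_symm_apply] at h1
    exact le_antisymm h1 (h.2 l)
  rcases R.pos_or_neg h with h | h
  · exact main α h
  · obtain ⟨w, i, hw⟩ := main _ h
    exact ⟨w ++ [i], i, by rw [wordEquiv_snoc_alphav, hw, neg_neg]⟩

lemma isUnit_of_smul_mem [NeZero n] (hfin : ∀ z : C.X, (R.Δ z).Finite) {x : C.X} {m : ℤ}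
    {v : Fin n → ℤ} (h : m • v ∈ R.Δ x) : IsUnit m := by
  obtain ⟨w, i, hw⟩ := exists_word_eq hfin h
  have h1 : alphav n i = m • (wordEquiv C x w).symm v := by
    rw [← map_smul, ← hw, LinearEquiv.symm_apply_apply]
  have h2 := congrFun h1 i
  rw [alphav_apply, if_pos rfl, Pi.smul_apply, smul_eq_mul] at h2
  exact isUnit_iff_exists_inv.mpr ⟨_, h2.symm⟩

/-! ### Rank two parabolics -/

lemma eq_of_support {j k : Fin n} (hjk : j ≠ k) {v : Fin n → ℤ}
    (h : ∀ l, l ≠ j → l ≠ k → v l = 0) : v = v j • alphav n j + v k • alphav n k := by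
  ext l
  simp only [Pi.add_apply, Pi.smul_apply, smul_eq_mul, alphav_apply]
  by_cases hj : l = j
  · subst hj
    simp [hjk]
  · by_cases hk : l = k
    · subst hk
      simp [hj]
    · simp [hj, hk, h l hj hk]

lemma cell_of_word [NeZero n] {x : C.X} {i k : Fin n} (hik : i ≠ k) {w : List (Fin n)}
    (hw : ∀ l ∈ w, l = i ∨ l = k) (hp : wordEquiv C x w (alphav n i) ∈ R.pos x)
    {u : Fin n → ℤ} (hu : ∀ l, 0 ≤ (wordEquiv C x w).symm u l)
    (hsupp : ∀ l, l ≠ i → l ≠ k → u l = 0)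
    (hneg : ¬ ∀ l, 0 ≤ (wordEquiv C x (w ++ [i])).symm u l) :
    ∃ (p q : Fin n → ℤ) (a b : ℤ), p ∈ R.pos x ∧ q ∈ R.Δ x ∧
      (∀ l, l ≠ i → l ≠ k → p l = 0) ∧ (∀ l, l ≠ i → l ≠ k → q l = 0) ∧
      0 ≤ a ∧ 0 ≤ b ∧ u = a • p + b • q ∧
      ∀ e ∈ R.Δ x, (∀ l, l ≠ i → l ≠ k → e l = 0) →
        ∃ z t : ℤ, z * t ≤ 0 ∧ e = z • p + t • q := by
  have hw' : ∀ l, l ≠ i → l ≠ k → l ∉ w ++ [i] := by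
    intro l hi hk hl
    rcases List.mem_append.mp hl with h | h
    · exact (hw l h).elim hi hk
    · exact hi (List.mem_singleton.mp h)
  have hp' : wordEquiv C x w (alphav n i) = -wordEquiv C x (w ++ [i]) (alphav n i) := by
    rw [wordEquiv_snoc_alphav, neg_neg]
  have hcoord : ∀ e : Fin n → ℤ, (∀ l, l ≠ i → l ≠ k → e l = 0) →
      ∀ l, l ≠ i → l ≠ k → (wordEquiv C x (w ++ [i])).symm e l = 0 := by
    intro e he l hi hk
    rw [wordEquiv_symm_apply_of_notMem x (hw' l hi hk), he l hi hk]
  have hsuppv : ∀ l', (l' = i ∨ l' = k) → ∀ l, l ≠ i → l ≠ k →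
      wordEquiv C x (w ++ [i]) (alphav n l') l = 0 := by
    intro l' hl' l hi hk
    rw [wordEquiv_apply_of_notMem x (hw' l hi hk), alphav_apply, if_neg]
    rcases hl' with rfl | rfl
    · exact hi
    · exact hk
  have hexp : ∀ e : Fin n → ℤ, (∀ l, l ≠ i → l ≠ k → e l = 0) →
      e = (-(wordEquiv C x (w ++ [i])).symm e i) • wordEquiv C x w (alphav n i) +
        (wordEquiv C x (w ++ [i])).symm e k • wordEquiv C x (w ++ [i]) (alphav n k) := by
    intro e he
    conv_lhs => rw [← (wordEquiv C x (w ++ [i])).apply_symm_apply e,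
      eq_of_support hik (hcoord e he)]
    rw [map_add, map_smul, map_smul, hp', neg_smul, smul_neg, neg_neg]
  have hk0 : 0 ≤ (wordEquiv C x (w ++ [i])).symm u k := by
    rw [wordEquiv_snoc_symm_apply, sMap_apply_of_ne hik.symm]
    exact hu k
  refine ⟨wordEquiv C x w (alphav n i), wordEquiv C x (w ++ [i]) (alphav n k), _, _, hp,
    wordEquiv_mem _ (alphav_mem _ k).1, ?_, hsuppv k (Or.inr rfl), ?_, hk0, hexp u hsupp, ?_⟩
  · intro l hi hk
    rw [hp', Pi.neg_apply, hsuppv i (Or.inl rfl) l hi hk, neg_zero]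
  · by_contra! h
    refine hneg fun l => ?_
    by_cases hi : l = i
    · subst hi
      omega
    · by_cases hk : l = k
      · rwa [hk]
      · exact (hcoord u hsupp l hi hk).ge
  · intro e he hes
    refine ⟨_, _, ?_, hexp e hes⟩
    rcases R.pos_or_neg (wordEquiv_symm_mem (w ++ [i]) he) with h | h
    · have h1 := h.2 i
      have h2 := h.2 k
      nlinarith
    · have h1 := h.2 i
      have h2 := h.2 k
      rw [Pi.neg_apply] at h1 h2
      nlinarith

lemma exists_cell [NeZero n] (hfin : ∀ z : C.X, (R.Δ z).Finite) {x : C.X} {j k : Fin n}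
    (hjk : j ≠ k) {u : Fin n → ℤ} (hu : ∀ l, 0 ≤ u l)
    (hsupp : ∀ l, l ≠ j → l ≠ k → u l = 0) (hu0 : u ≠ 0) :
    ∃ (p q : Fin n → ℤ) (a b : ℤ), p ∈ R.pos x ∧ q ∈ R.Δ x ∧
      (∀ l, l ≠ j → l ≠ k → p l = 0) ∧ (∀ l, l ≠ j → l ≠ k → q l = 0) ∧
      0 ≤ a ∧ 0 ≤ b ∧ u = a • p + b • q ∧
      ∀ e ∈ R.Δ x, (∀ l, l ≠ j → l ≠ k → e l = 0) →
        ∃ z t : ℤ, z * t ≤ 0 ∧ e = z • p + t • q := by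
  obtain ⟨w, ⟨hw, hwu⟩, hmax⟩ := exists_not_extends hfin x
    (P := fun w => (∀ l ∈ w, l = j ∨ l = k) ∧ ∀ l, 0 ≤ (wordEquiv C x w).symm u l)
    ⟨by simp, hu⟩
  have hext : ∀ i, (i = j ∨ i = k) → wordEquiv C x w (alphav n i) ∈ R.pos x →
      ¬ ∀ l, 0 ≤ (wordEquiv C x (w ++ [i])).symm u l := by
    intro i hi hpos h
    refine hmax i hpos ⟨fun l hl => ?_, h⟩
    rcases List.mem_append.mp hl with h | h
    · exact hw l h
    · rwa [List.mem_singleton.mp h]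
  by_cases hj : wordEquiv C x w (alphav n j) ∈ R.pos x
  · exact cell_of_word hjk hw hj hwu hsupp (hext j (Or.inl rfl) hj)
  by_cases hk : wordEquiv C x w (alphav n k) ∈ R.pos x
  · obtain ⟨p, q, a, b, h1, h2, h3, h4, h5, h6, h7, h8⟩ :=
      cell_of_word hjk.symm (fun l hl => (hw l hl).symm) hk hwu
        (fun l h h' => hsupp l h' h) (hext k (Or.inr rfl) hk)
    exact ⟨p, q, a, b, h1, h2, fun l h h' => h3 l h' h, fun l h h' => h4 l h' h, h5, h6, h7,
      fun e he hes => h8 e he fun l h h' => hes l h' h⟩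
  exfalso
  refine hu0 (funext fun l => le_antisymm ?_ (hu l))
  rw [← (wordEquiv C x w).apply_symm_apply u]
  refine apply_nonpos (R := R) hwu (fun i hi => ?_) l
  refine (R.pos_or_neg (wordEquiv_mem w (alphav_mem _ i).1)).resolve_left ?_
  by_cases hij : i = j
  · rwa [hij]
  by_cases hik : i = k
  · rwa [hik]
  refine absurd ?_ hi
  rw [wordEquiv_symm_apply_of_notMem x (fun h => (hw i h).elim hij hik), hsupp i hij hik]

lemma rankTwoFan [NeZero n] (hfin : ∀ z : C.X, (R.Δ z).Finite) (x : C.X) {j k : Fin n}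
    (hjk : j ≠ k) :
    RankTwoFan fun a b : ℤ => a • alphav n j + b • alphav n k ∈ R.Δ x := by
  have cj : ∀ a b : ℤ, (a • alphav n j + b • alphav n k) j = a := by
    intro a b
    simp [alphav_apply, hjk]
  have ck : ∀ a b : ℤ, (a • alphav n j + b • alphav n k) k = b := by
    intro a b
    simp [alphav_apply, hjk.symm]
  have cl : ∀ (a b : ℤ) (l), l ≠ j → l ≠ k → (a • alphav n j + b • alphav n k) l = 0 := by
    intro a b l hj hk
    simp [alphav_apply, hj, hk]
  constructor
  · simpa using (alphav_mem x j).1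
  · simpa using (alphav_mem x k).1
  · intro a b h
    rcases R.pos_or_neg h with h | h
    · left
      have h1 := h.2 j
      have h2 := h.2 k
      rw [cj] at h1
      rw [ck] at h2
      exact ⟨h1, h2⟩
    · right
      have h1 := h.2 j
      have h2 := h.2 k
      rw [Pi.neg_apply, cj] at h1
      rw [Pi.neg_apply, ck] at h2
      omega
  · intro a b h
    obtain ⟨a', ha⟩ := Int.gcd_dvd_left a b
    obtain ⟨b', hb⟩ := Int.gcd_dvd_right a b
    have h1 : ((Int.gcd a b : ℕ) : ℤ) • (a' • alphav n j + b' • alphav n k) ∈ R.Δ x := by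
      rw [smul_add, smul_smul, smul_smul, ← ha, ← hb]
      exact h
    have h2 := isUnit_of_smul_mem hfin h1
    rw [Int.isCoprime_iff_gcd_eq_one]
    rw [Int.isUnit_iff] at h2
    omega
  · intro c d hc hd hcd
    obtain ⟨p, q, a, b, hp, hq, hps, hqs, ha, hb, hu, H⟩ := exists_cell (R := R) hfin (x := x)
      hjk (u := c • alphav n j + d • alphav n k)
      (fun l => by
        by_cases hj : l = j
        · rw [hj, cj]; exact hc
        by_cases hk : l = k
        · rw [hk, ck]; exact hd
        exact (cl _ _ l hj hk).ge)
      (cl c d)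
      (fun h => by
        have h1 := congrFun h j
        have h2 := congrFun h k
        rw [cj] at h1
        rw [ck] at h2
        exact hcd.elim (· h1) (· h2))
    refine ⟨p j, p k, q j, q k, a, b, ?_, hp.2 j, hp.2 k, ?_, ha, hb, ?_, ?_, ?_⟩
    · rw [← eq_of_support hjk hps]
      exact hp.1
    · rw [← eq_of_support hjk hqs]
      exact hq
    · have := congrFun hu j
      rwa [cj] at this
    · have := congrFun hu k
      rwa [ck] at this
    · intro e f hef
      obtain ⟨z, t, hzt, he⟩ := H _ hef (cl e f)
      refine ⟨z, t, hzt, ?_, ?_⟩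
      · have := congrFun he j
        rwa [cj] at this
      · have := congrFun he k
        rwa [ck] at this

lemma exists_add_of_support [NeZero n] (hfin : ∀ z : C.X, (R.Δ z).Finite) {x : C.X}
    {j k : Fin n} (hjk : j ≠ k) {β : Fin n → ℤ} (hβ : β ∈ R.pos x)
    (hsupp : ∀ l, l ≠ j → l ≠ k → β l = 0) (hj : β ≠ alphav n j) (hk : β ≠ alphav n k) :
    ∃ γ ∈ R.pos x, ∃ δ ∈ R.pos x, β = γ + δ ∧ (∀ l, l ≠ j → l ≠ k → γ l = 0) ∧
      ∀ l, l ≠ j → l ≠ k → δ l = 0 := by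
  have hβj : 1 ≤ β j := by
    obtain ⟨l, hl, hl'⟩ := exists_pos_apply hβ hk
    by_cases h : l = j
    · subst h; omega
    · have := hsupp l h hl; omega
  have hβk : 1 ≤ β k := by
    obtain ⟨l, hl, hl'⟩ := exists_pos_apply hβ hj
    by_cases h : l = k
    · subst h; omega
    · have := hsupp l hl h; omega
  have cl : ∀ (a b : ℤ) (l), l ≠ j → l ≠ k → (a • alphav n j + b • alphav n k) l = 0 := by
    intro a b l hj hk
    simp [alphav_apply, hj, hk]
  have hnn : ∀ a b : ℤ, 0 ≤ a → 0 ≤ b → ∀ l, 0 ≤ (a • alphav n j + b • alphav n k) l :=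
    fun a b ha hb l => add_nonneg (mul_nonneg ha ((alphav_mem (R := R) x j).2 l))
      (mul_nonneg hb ((alphav_mem (R := R) x k).2 l))
  have hexp := eq_of_support hjk hsupp
  obtain ⟨c, d, h1, h2, hc, hca, hd, hdb⟩ := (rankTwoFan hfin x hjk).exists_add
    (show β j • alphav n j + β k • alphav n k ∈ R.Δ x from hexp ▸ hβ.1) hβj hβk
  refine ⟨_, ⟨h1, hnn _ _ hc hd⟩, _, ⟨h2, hnn _ _ (by omega) (by omega)⟩, ?_, cl _ _, cl _ _⟩
  conv_lhs => rw [hexp]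
  module

/-! ### Every positive root is simple or a sum of two positive roots -/

lemma eq_alphav_of_forall_pos [NeZero n] {x : C.X} {w : List (Fin n)} {j : Fin n}
    (hw : ∀ k, wordEquiv C x w (alphav n k) ∈ R.pos x) :
    ∃ l, wordEquiv C x w (alphav n j) = alphav n l := by
  set α := wordEquiv C x w (alphav n j) with hα
  have hpre : ∀ v : Fin n → ℤ, v ∈ R.pos x →
      (wordEquiv C x w).symm v ∈ R.pos (wordEnd C x w) := by
    intro v hv
    refine (R.pos_or_neg (wordEquiv_symm_mem w hv.1)).resolve_right fun h => ?_
    refine neg_notMem_pos hv ⟨neg_mem hv.1, fun l => ?_⟩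
    have := apply_nonneg (R := R) h.2 (fun i _ => hw i) l
    rwa [map_neg, LinearEquiv.apply_symm_apply] at this
  obtain ⟨l, hl⟩ : ∃ l, α l ≠ 0 := by
    by_contra! h
    exact ne_zero (hw j).1 (funext h)
  refine ⟨l, ?_⟩
  have hl1 : 1 ≤ α l := by
    have := (hw j).2 l
    change 0 ≤ α l at this
    omega
  -- `α - α_l` is nonnegative, hence so is its preimage `α_j - w⁻¹ α_l`
  have hdiff : ∀ m, 0 ≤ (wordEquiv C x w).symm (α - alphav n l) m := by
    intro m
    rw [eq_sum_alphav (α - alphav n l), map_sum, Finset.sum_apply]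
    refine Finset.sum_nonneg fun i _ => ?_
    rw [map_smul, Pi.smul_apply, smul_eq_mul]
    refine mul_nonneg ?_ ((hpre _ (alphav_mem x i)).2 m)
    rw [Pi.sub_apply, alphav_apply]
    split_ifs with h
    · subst h; omega
    · have := (hw j).2 i
      simpa using this
  rw [← (wordEquiv C x w).apply_symm_apply (alphav n l), hα]
  congr 1
  by_contra hne
  obtain ⟨m, hm, hm'⟩ := exists_pos_apply (hpre _ (alphav_mem x l)) (Ne.symm hne)
  have := hdiff m
  rw [map_sub, hα, LinearEquiv.symm_apply_apply, Pi.sub_apply, alphav_apply, if_neg hm] at this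
  omega

/-- Every nonsimple positive root is a sum of two positive roots. -/
theorem exists_add [NeZero n] (hfin : ∀ z : C.X, (R.Δ z).Finite) {x : C.X} {α : Fin n → ℤ}
    (hα : α ∈ R.pos x) (hs : ∀ i, α ≠ alphav n i) :
    ∃ β ∈ R.pos x, ∃ γ ∈ R.pos x, α = β + γ := by
  have hex : ∃ (m : ℕ) (w : List (Fin n)) (i : Fin n),
      wordEquiv C x w (alphav n i) = α ∧ (R.inversions x w).ncard = m := by
    obtain ⟨w, i, h⟩ := exists_word_eq hfin hα.1
    exact ⟨_, w, i, h, rfl⟩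
  classical
  obtain ⟨w, j, hw, hwm⟩ := Nat.find_spec hex
  have hmin : ∀ (v : List (Fin n)) (i : Fin n), wordEquiv C x v (alphav n i) = α →
      (R.inversions x w).ncard ≤ (R.inversions x v).ncard :=
    fun v i h => hwm ▸ Nat.find_min' hex ⟨v, i, h, rfl⟩
  obtain ⟨k, hk⟩ : ∃ k, -wordEquiv C x w (alphav n k) ∈ R.pos x := by
    by_contra! H
    obtain ⟨l, hl⟩ := eq_alphav_of_forall_pos (R := R) (x := x) (w := w) (j := j) fun k =>
      (R.pos_or_neg (wordEquiv_mem w (alphav_mem _ k).1)).resolve_right (H k)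
    exact hs l (hw ▸ hl)
  have hjk : j ≠ k := by
    rintro rfl
    rw [hw] at hk
    exact neg_notMem_pos hα hk
  -- a representative of minimal length in the rank two coset of `w`
  have hex' : ∃ (m : ℕ) (v : List (Fin n)), (∀ l ∈ v, l = j ∨ l = k) ∧
      (R.inversions x (w ++ v)).ncard = m := ⟨_, [], by simp, rfl⟩
  obtain ⟨v, hv, hvm⟩ := Nat.find_spec hex'
  have hmin' : ∀ u : List (Fin n), (∀ l ∈ u, l = j ∨ l = k) →
      (R.inversions x (w ++ v)).ncard ≤ (R.inversions x (w ++ u)).ncard :=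
    fun u h => hvm ▸ Nat.find_min' hex' ⟨u, h, rfl⟩
  have hlt : (R.inversions x (w ++ v)).ncard < (R.inversions x w).ncard := by
    have h1 := hmin' [k] (by simp)
    have h2 := ncard_inversions_of_neg hfin hk
    omega
  have hpos : ∀ i, (i = j ∨ i = k) → wordEquiv C x (w ++ v) (alphav n i) ∈ R.pos x := by
    intro i hi
    refine (R.pos_or_neg (wordEquiv_mem (w ++ v) (alphav_mem _ i).1)).resolve_right fun h => ?_
    have h1 := hmin' (v ++ [i]) fun l hl => by
      rcases List.mem_append.mp hl with h | h
      · exact hv l h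
      · rwa [List.mem_singleton.mp h]
    have h2 := ncard_inversions_of_neg hfin h
    rw [← List.append_assoc] at h1
    omega
  have hposv : ∀ e : Fin n → ℤ, (∀ l, 0 ≤ e l) → (∀ l, l ≠ j → l ≠ k → e l = 0) →
      ∀ l, 0 ≤ wordEquiv C x (w ++ v) e l := by
    intro e he hes
    refine apply_nonneg (R := R) he fun i hi => hpos i ?_
    by_contra! h
    exact hi (hes i h.1 h.2)
  set β := (wordEquiv C x (w ++ v)).symm α with hβ
  have hwβ : wordEquiv C x (w ++ v) β = α := LinearEquiv.apply_symm_apply _ _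
  have hβs : ∀ l, l ≠ j → l ≠ k → β l = 0 := by
    intro l hj hk
    have h1 : β = (wordEquiv C (wordEnd C x w) v).symm (alphav n j) := by
      rw [hβ, wordEquiv_append, ← hw, LinearEquiv.trans_symm, LinearEquiv.trans_apply,
        LinearEquiv.symm_apply_apply]
    rw [h1, wordEquiv_symm_apply_of_notMem _ (fun h => (hv l h).elim hj hk), alphav_apply,
      if_neg hj]
  have hβpos : β ∈ R.pos (wordEnd C x (w ++ v)) := by
    refine (R.pos_or_neg (wordEquiv_symm_mem (w ++ v) hα.1)).resolve_right fun h => ?_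
    refine neg_notMem_pos hα ⟨neg_mem hα.1, ?_⟩
    have h1 := hposv _ h.2 fun l hj hk => by
      rw [Pi.neg_apply, neg_eq_zero]
      exact hβs l hj hk
    rwa [map_neg, LinearEquiv.apply_symm_apply] at h1
  have hβi : ∀ i, β ≠ alphav n i := by
    intro i h
    have := hmin (w ++ v) i (by rw [← h, hwβ])
    omega
  obtain ⟨γ, hγ, δ, hδ, h, hγs, hδs⟩ :=
    exists_add_of_support hfin hjk hβpos hβs (hβi j) (hβi k)
  refine ⟨wordEquiv C x (w ++ v) γ, ⟨wordEquiv_mem _ hγ.1, hposv γ hγ.2 hγs⟩,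
    wordEquiv C x (w ++ v) δ, ⟨wordEquiv_mem _ hδ.1, hposv δ hδ.2 hδs⟩, ?_⟩
  rw [← map_add, ← h, hwβ]

/-! ### Inversions of prefixes of a word -/

lemma wordRoot_eq (x : C.X) (w : List (Fin n)) (j : Fin w.length) :
    wordRoot C x w j = wordEquiv C x (w.take j) (alphav n (w.get j)) := by
  rw [coe_wordEquiv]; rfl

lemma inversions_take [NeZero n] {x : C.X} {w : List (Fin n)}
    (hw : ∀ j : Fin w.length, wordRoot C x w j ∈ R.pos x) {t : ℕ} (ht : t ≤ w.length) :
    R.inversions x (w.take t) = {β | ∃ j : Fin w.length, (j : ℕ) < t ∧ wordRoot C x w j = β} := by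
  induction t with
  | zero => simp [inversions_nil]
  | succ t ih =>
    have h1 : w.take (t + 1) = w.take t ++ [w.get ⟨t, ht⟩] := by simp
    have h2 := hw ⟨t, ht⟩
    rw [wordRoot_eq] at h2
    rw [h1, inversions_snoc h2, ih (by omega)]
    ext β
    simp only [Set.mem_insert_iff, Set.mem_ofPred_eq]
    constructor
    · rintro (rfl | ⟨j, hj, rfl⟩)
      · exact ⟨⟨t, ht⟩, Nat.lt_succ_self t, wordRoot_eq _ _ _⟩
      · exact ⟨j, by omega, rfl⟩
    · rintro ⟨j, hj, rfl⟩
      rcases Nat.lt_succ_iff_lt_or_eq.mp hj with h | h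
      · exact Or.inr ⟨j, h, rfl⟩
      · left
        obtain rfl : j = ⟨t, ht⟩ := Fin.ext h
        exact wordRoot_eq _ _ _

lemma inversions_eq_range [NeZero n] {x : C.X} {w : List (Fin n)}
    (hw : ∀ j : Fin w.length, wordRoot C x w j ∈ R.pos x) :
    R.inversions x w = Set.range (wordRoot C x w) := by
  have := inversions_take hw le_rfl
  rw [List.take_length] at this
  rw [this]
  ext β
  simp

lemma wordRoot_snoc_of_lt (x : C.X) (w : List (Fin n)) (i : Fin n) (j : Fin (w ++ [i]).length)
    (hj : (j : ℕ) < w.length) : wordRoot C x (w ++ [i]) j = wordRoot C x w ⟨j, hj⟩ := by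
  simp [wordRoot, List.take_append_of_le_length hj.le, List.getElem_append_left hj]

lemma wordRoot_snoc_of_eq (x : C.X) (w : List (Fin n)) (i : Fin n) (j : Fin (w ++ [i]).length)
    (hj : (j : ℕ) = w.length) : wordRoot C x (w ++ [i]) j = wordEquiv C x w (alphav n i) := by
  simp [wordRoot, hj, coe_wordEquiv]

lemma sum_notMem_inversions [NeZero n] {ι : Type*} [Fintype ι] {x : C.X} {w : List (Fin n)}
    {γ : ι → Fin n → ℤ} (hγ : ∀ p, γ p ∈ R.pos x) (h : ∀ p, γ p ∉ R.inversions x w)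
    (hs : ∑ p, γ p ∈ R.pos x) : ∑ p, γ p ∉ R.inversions x w := by
  refine notMem_inversions ⟨wordEquiv_symm_mem w hs.1, fun l => ?_⟩
  rw [map_sum, Finset.sum_apply]
  exact Finset.sum_nonneg fun p _ => (symm_mem_pos (hγ p) (h p)).2 l

lemma sum_mem_inversions {ι : Type*} [Fintype ι] {x : C.X} {w : List (Fin n)}
    {γ : ι → Fin n → ℤ} (h : ∀ p, γ p ∈ R.inversions x w)
    (hs : ∑ p, γ p ∈ R.pos x) : ∑ p, γ p ∈ R.inversions x w := by
  refine ⟨hs, neg_mem (wordEquiv_symm_mem w hs.1), fun l => ?_⟩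
  rw [map_sum, Pi.neg_apply, Finset.sum_apply, ← Finset.sum_neg_distrib]
  exact Finset.sum_nonneg fun p _ => (h p).2.2 l

lemma sum_ne [NeZero n] {m : ℕ} {x : C.X} {γ : Fin (m + 2) → Fin n → ℤ}
    (hγ : ∀ p, γ p ∈ R.pos x) (p : Fin (m + 2)) : ∑ q, γ q ≠ γ p := by
  intro h
  obtain ⟨p', hp'⟩ := exists_ne p
  refine ne_zero (hγ p').1 (funext fun l => le_antisymm ?_ ((hγ p').2 l))
  have h1 := Finset.single_le_sum (f := fun q => γ q l) (s := Finset.univ.erase p)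
    (fun q _ => (hγ q).2 l) (Finset.mem_erase.mpr ⟨hp', Finset.mem_univ _⟩)
  have h2 := Finset.add_sum_erase Finset.univ (fun q => γ q l) (Finset.mem_univ p)
  have h3 := congrFun h l
  rw [Finset.sum_apply] at h3
  simp only [Pi.zero_apply] at *
  omega

/-! ### Convex orders -/

section Orders

variable {x : C.X} {lt : (Fin n → ℤ) → (Fin n → ℤ) → Prop}

lemma stronglyConvex_of_word [NeZero n]
    (hirr : ∀ a ∈ R.pos x, ¬ lt a a)
    (htrans : ∀ a ∈ R.pos x, ∀ b ∈ R.pos x, ∀ c ∈ R.pos x, lt a b → lt b c → lt a c)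
    (htotal : ∀ a ∈ R.pos x, ∀ b ∈ R.pos x, a ≠ b → lt a b ∨ lt b a)
    {w : List (Fin n)} (hw : ∀ j : Fin w.length, wordRoot C x w j ∈ R.pos x)
    (hsurj : ∀ α ∈ R.pos x, ∃ j : Fin w.length, wordRoot C x w j = α)
    (hmono : ∀ j j' : Fin w.length, j < j' → lt (wordRoot C x w j) (wordRoot C x w j'))
    (m : ℕ) (γ : Fin (m + 2) → (Fin n → ℤ)) (hγ : ∀ p, γ p ∈ R.pos x)
    (hle : ∀ p p' : Fin (m + 2), p ≤ p' → γ p = γ p' ∨ lt (γ p) (γ p'))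
    (hs : ∑ p, γ p ∈ R.pos x) :
    lt (γ 0) (∑ p, γ p) ∧ lt (∑ p, γ p) (γ (Fin.last (m + 1))) := by
  obtain ⟨j, hj⟩ := hsurj _ hs
  have hasymm : ∀ a ∈ R.pos x, ∀ b ∈ R.pos x, lt a b → ¬ lt b a :=
    fun a ha b hb h h' => hirr a ha (htrans a ha b hb a ha h h')
  constructor
  · refine (htotal _ (hγ 0) _ hs (sum_ne hγ 0).symm).resolve_right fun h => ?_
    have h1 : ∀ p, lt (∑ p, γ p) (γ p) := by
      intro p
      rcases hle 0 p (Fin.zero_le p) with h' | h'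
      · rwa [← h']
      · exact htrans _ hs _ (hγ 0) _ (hγ p) h h'
    refine sum_notMem_inversions (w := w.take (j + 1)) hγ (fun p => ?_) hs ?_
    · rw [inversions_take hw (by omega)]
      rintro ⟨i, hi, hi'⟩
      have h2 := h1 p
      rw [← hi', ← hj] at h2
      rcases (show i ≤ j from Nat.lt_succ_iff.mp hi).lt_or_eq with h3 | h3
      · exact hasymm _ (hw i) _ (hw j) (hmono i j h3) h2
      · subst h3
        exact hirr _ (hw i) h2
    · rw [inversions_take hw (by omega)]
      exact ⟨j, Nat.lt_succ_self j, hj⟩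
  · refine (htotal _ hs _ (hγ _) (sum_ne hγ _)).resolve_right fun h => ?_
    have h1 : ∀ p, lt (γ p) (∑ p, γ p) := by
      intro p
      rcases hle p _ (Fin.le_last p) with h' | h'
      · rwa [h']
      · exact htrans _ (hγ p) _ (hγ _) _ hs h' h
    have h2 : ∑ p, γ p ∈ R.inversions x (w.take j) := by
      refine sum_mem_inversions (fun p => ?_) hs
      rw [inversions_take hw j.2.le]
      obtain ⟨i, hi⟩ := hsurj _ (hγ p)
      refine ⟨i, ?_, hi⟩
      by_contra! h3
      have h4 := h1 p
      rw [← hi, ← hj] at h4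
      rcases (show j ≤ i from h3).lt_or_eq with h5 | h5
      · exact hasymm _ (hw j) _ (hw i) (hmono j i h5) h4
      · subst h5
        exact hirr _ (hw j) h4
    rw [inversions_take hw j.2.le] at h2
    obtain ⟨i, hi, hi'⟩ := h2
    have h3 := hmono i j hi
    rw [hi', hj] at h3
    exact hirr _ hs h3

lemma convex_of_stronglyConvex
    (h : ∀ (m : ℕ) (γ : Fin (m + 2) → (Fin n → ℤ)),
      (∀ p, γ p ∈ R.pos x) →
      (∀ p p' : Fin (m + 2), p ≤ p' → γ p = γ p' ∨ lt (γ p) (γ p')) →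
      (∑ p, γ p) ∈ R.pos x →
      lt (γ 0) (∑ p, γ p) ∧ lt (∑ p, γ p) (γ (Fin.last (m + 1))))
    (a : Fin n → ℤ) (ha : a ∈ R.pos x) (b : Fin n → ℤ) (hb : b ∈ R.pos x) (hab : lt a b)
    (hs : a + b ∈ R.pos x) : lt a (a + b) ∧ lt (a + b) b := by
  have h1 := h 0 ![a, b]
  rw [Fin.sum_univ_two] at h1
  refine h1 (fun p => ?_) (fun p p' hp => ?_) hs
  · fin_cases p
    · exact ha
    · exact hb
  · fin_cases p <;> fin_cases p'
    · exact Or.inl rfl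
    · exact Or.inr hab
    · exact absurd hp (by decide)
    · exact Or.inl rfl

lemma exists_min
    (htrans : ∀ a ∈ R.pos x, ∀ b ∈ R.pos x, ∀ c ∈ R.pos x, lt a b → lt b c → lt a c)
    (htotal : ∀ a ∈ R.pos x, ∀ b ∈ R.pos x, a ≠ b → lt a b ∨ lt b a)
    {T : Set (Fin n → ℤ)} (hT : T.Finite) (hne : T.Nonempty) (hTx : T ⊆ R.pos x) :
    ∃ a ∈ T, ∀ b ∈ T, b ≠ a → lt a b := by
  induction T, hT using Set.Finite.induction_on with
  | empty => exact absurd hne Set.not_nonempty_empty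
  | @insert c T _ _ ih =>
    have hc := hTx (Set.mem_insert c T)
    have hTx' := (Set.subset_insert c T).trans hTx
    rcases T.eq_empty_or_nonempty with rfl | hT'
    · refine ⟨c, by simp, fun b hb hbc => ?_⟩
      simp at hb
      exact absurd hb hbc
    obtain ⟨a, ha, hmin⟩ := ih hT' hTx'
    by_cases hca : c = a
    · subst hca
      refine ⟨c, by simp, fun b hb hbc => ?_⟩
      exact hmin b (hb.resolve_left hbc) hbc
    rcases htotal c hc a (hTx' ha) hca with h | h
    · refine ⟨c, by simp, fun b hb hbc => ?_⟩
      have hb' := hb.resolve_left hbc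
      by_cases hba : b = a
      · rwa [hba]
      · exact htrans c hc a (hTx' ha) b (hTx' hb') h (hmin b hb' hba)
    · refine ⟨a, Or.inr ha, fun b hb hba => ?_⟩
      rcases hb with rfl | hb
      · exact h
      · exact hmin b hb hba

/-- If the inversions of `w` form an initial segment of a convex order, then the least
remaining positive root is the image of a simple root under `w`. -/
lemma exists_apply_alphav_eq_min [NeZero n] (hfin : ∀ z : C.X, (R.Δ z).Finite)
    (hirr : ∀ a ∈ R.pos x, ¬ lt a a)
    (htrans : ∀ a ∈ R.pos x, ∀ b ∈ R.pos x, ∀ c ∈ R.pos x, lt a b → lt b c → lt a c)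
    (htotal : ∀ a ∈ R.pos x, ∀ b ∈ R.pos x, a ≠ b → lt a b ∨ lt b a)
    (hconv : ∀ a ∈ R.pos x, ∀ b ∈ R.pos x, lt a b → a + b ∈ R.pos x →
      lt a (a + b) ∧ lt (a + b) b)
    {w : List (Fin n)} {γ : Fin n → ℤ} (hγ : γ ∈ R.pos x) (hγw : γ ∉ R.inversions x w)
    (hinit : ∀ β ∈ R.inversions x w, lt β γ)
    (hmin : ∀ α ∈ R.pos x, α ∉ R.inversions x w → α ≠ γ → lt γ α) :
    ∃ i, wordEquiv C x w (alphav n i) = γ := by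
  have hasymm : ∀ a ∈ R.pos x, ∀ b ∈ R.pos x, lt a b → ¬ lt b a :=
    fun a ha b hb h h' => hirr a ha (htrans a ha b hb a ha h h')
  by_contra! H
  obtain ⟨δ₁, hδ₁, δ₂, hδ₂, hδ⟩ := exists_add hfin (symm_mem_pos hγ hγw)
    (fun i h => H i (by rw [← h, LinearEquiv.apply_symm_apply]))
  have hsum : γ = wordEquiv C x w δ₁ + wordEquiv C x w δ₂ := by
    rw [← map_add, ← hδ, LinearEquiv.apply_symm_apply]
  have hout : ∀ δ ∈ R.pos (wordEnd C x w),
      wordEquiv C x w δ ∉ R.inversions x w := fun δ h =>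
    notMem_inversions (by rwa [LinearEquiv.symm_apply_apply])
  have hin : ∀ δ ∈ R.pos (wordEnd C x w), -wordEquiv C x w δ ∈ R.pos x →
      -wordEquiv C x w δ ∈ R.inversions x w := fun δ h h' =>
    ⟨h', by rwa [map_neg, LinearEquiv.symm_apply_apply, neg_neg]⟩
  -- the case where exactly one summand becomes negative
  have mixed : ∀ δ ∈ R.pos (wordEnd C x w), ∀ ε ∈ R.pos (wordEnd C x w),
      γ = wordEquiv C x w δ + wordEquiv C x w ε → wordEquiv C x w δ ∈ R.pos x →
      -wordEquiv C x w ε ∈ R.pos x → False := by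
    intro δ hδ ε hε h h1 h2
    have h3 : -wordEquiv C x w ε + γ = wordEquiv C x w δ := by rw [h]; abel
    have h4 := (hconv _ h2 _ hγ (hinit _ (hin ε hε h2)) (h3 ▸ h1)).2
    rw [h3] at h4
    by_cases h5 : wordEquiv C x w δ = γ
    · rw [h5] at h4
      exact hirr _ hγ h4
    · exact hasymm _ h1 _ hγ h4 (hmin _ h1 (hout δ hδ) h5)
  rcases R.pos_or_neg (wordEquiv_mem w hδ₁.1) with h1 | h1 <;>
    rcases R.pos_or_neg (wordEquiv_mem w hδ₂.1) with h2 | h2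
  · have e1 : wordEquiv C x w δ₁ ≠ γ := fun h => ne_zero h2.1 (by simpa [h] using hsum)
    have e2 : wordEquiv C x w δ₂ ≠ γ := fun h => ne_zero h1.1 (by simpa [h] using hsum)
    have l1 := hmin _ h1 (hout _ hδ₁) e1
    have l2 := hmin _ h2 (hout _ hδ₂) e2
    by_cases h12 : wordEquiv C x w δ₁ = wordEquiv C x w δ₂
    · have h3 : (2 : ℤ) • wordEquiv C x w δ₂ ∈ R.Δ x := by
        rw [two_smul]
        rw [h12] at hsum
        exact hsum ▸ hγ.1
      have := isUnit_of_smul_mem hfin h3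
      rw [Int.isUnit_iff] at this
      omega
    · rcases htotal _ h1 _ h2 h12 with h3 | h3
      · have h4 := (hconv _ h1 _ h2 h3 (hsum ▸ hγ)).1
        rw [← hsum] at h4
        exact hasymm _ hγ _ h1 l1 h4
      · rw [add_comm] at hsum
        have h4 := (hconv _ h2 _ h1 h3 (hsum ▸ hγ)).1
        rw [← hsum] at h4
        exact hasymm _ hγ _ h2 l2 h4
  · exact mixed _ hδ₁ _ hδ₂ hsum h1 h2
  · exact mixed _ hδ₂ _ hδ₁ (by rw [hsum, add_comm]) h2 h1
  · refine ne_zero hγ.1 (funext fun l => le_antisymm ?_ (hγ.2 l))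
    have e1 := h1.2 l
    have e2 := h2.2 l
    have e3 := congrFun hsum l
    simp only [Pi.neg_apply, Pi.add_apply, Pi.zero_apply] at *
    omega

lemma exists_word_initial [NeZero n] (hfin : ∀ z : C.X, (R.Δ z).Finite)
    (hirr : ∀ a ∈ R.pos x, ¬ lt a a)
    (htrans : ∀ a ∈ R.pos x, ∀ b ∈ R.pos x, ∀ c ∈ R.pos x, lt a b → lt b c → lt a c)
    (htotal : ∀ a ∈ R.pos x, ∀ b ∈ R.pos x, a ≠ b → lt a b ∨ lt b a)
    (hconv : ∀ a ∈ R.pos x, ∀ b ∈ R.pos x, lt a b → a + b ∈ R.pos x →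
      lt a (a + b) ∧ lt (a + b) b) (t : ℕ) (ht : t ≤ (R.pos x).ncard) :
    ∃ w : List (Fin n), w.length = t ∧ (∀ j : Fin w.length, wordRoot C x w j ∈ R.pos x) ∧
      (∀ j j' : Fin w.length, j < j' → lt (wordRoot C x w j) (wordRoot C x w j')) ∧
      ∀ α ∈ R.pos x, α ∉ R.inversions x w → ∀ β ∈ R.inversions x w, lt β α := by
  induction t with
  | zero => exact ⟨[], rfl, fun j => j.elim0, fun j => j.elim0, by simp [inversions_nil]⟩
  | succ t ih =>
    obtain ⟨w, rfl, hw, hmono, hinit⟩ := ih (by omega)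
    have hposfin : (R.pos x).Finite := (hfin x).subset fun _ h => h.1
    have hne : (R.pos x \ R.inversions x w).Nonempty := by
      refine Set.sdiff_nonempty_of_ncard_lt_ncard ?_ (inversions_finite hfin x w)
      have := ncard_inversions_le_length (R := R) hfin x w
      omega
    obtain ⟨γ, ⟨hγ, hγw⟩, hmin⟩ := exists_min htrans htotal (hposfin.subset Set.sdiff_subset) hne
      Set.sdiff_subset
    obtain ⟨i, rfl⟩ := exists_apply_alphav_eq_min hfin hirr htrans htotal hconv hγ hγw
      (hinit _ hγ hγw) (fun α h h' => hmin α ⟨h, h'⟩)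
    have hrange := inversions_eq_range hw
    have hcases : ∀ j : Fin (w ++ [i]).length, (j : ℕ) < w.length ∨ (j : ℕ) = w.length := by
      intro j
      have hj := j.2
      have hl : (w ++ [i]).length = w.length + 1 := by simp
      omega
    refine ⟨w ++ [i], by simp, fun j => ?_, fun j j' hjj => ?_, ?_⟩
    · rcases hcases j with h | h
      · rw [wordRoot_snoc_of_lt x w i j h]
        exact hw _
      · rwa [wordRoot_snoc_of_eq x w i j h]
    · have hjj' : (j : ℕ) < j' := hjj
      rcases hcases j' with h | h
      · rw [wordRoot_snoc_of_lt x w i j (hjj'.trans h), wordRoot_snoc_of_lt x w i j' h]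
        exact hmono _ _ hjj'
      · rw [wordRoot_snoc_of_lt x w i j (by omega), wordRoot_snoc_of_eq x w i j' h]
        exact hinit _ hγ hγw _ (hrange ▸ Set.mem_range_self _)
    · rw [inversions_snoc hγ]
      intro α hα hα' β hβ
      rw [Set.mem_insert_iff, not_or] at hα'
      rcases hβ with rfl | hβ
      · exact hmin α ⟨hα, hα'.2⟩ hα'.1
      · exact hinit α hα hα'.2 β hβ

lemma exists_word_of_convex [NeZero n] (hfin : ∀ z : C.X, (R.Δ z).Finite) {M : ℕ}
    (hM : (R.pos x).ncard = M)
    (hirr : ∀ a ∈ R.pos x, ¬ lt a a)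
    (htrans : ∀ a ∈ R.pos x, ∀ b ∈ R.pos x, ∀ c ∈ R.pos x, lt a b → lt b c → lt a c)
    (htotal : ∀ a ∈ R.pos x, ∀ b ∈ R.pos x, a ≠ b → lt a b ∨ lt b a)
    (hconv : ∀ a ∈ R.pos x, ∀ b ∈ R.pos x, lt a b → a + b ∈ R.pos x →
      lt a (a + b) ∧ lt (a + b) b) :
    ∃ (y : C.X) (φ : (Fin n → ℤ) → (Fin n → ℤ)) (w : List (Fin n)),
      w.length = M ∧ IsReduced C x y φ w ∧
      (∀ j : Fin w.length, wordRoot C x w j ∈ R.pos x) ∧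
      (∀ α ∈ R.pos x, ∃ j : Fin w.length, wordRoot C x w j = α) ∧
      (∀ j j' : Fin w.length, j < j' → lt (wordRoot C x w j) (wordRoot C x w j')) := by
  obtain ⟨w, hlen, hw, hmono, -⟩ :=
    exists_word_initial hfin hirr htrans htotal hconv M hM.ge
  have hposfin : (R.pos x).Finite := (hfin x).subset fun _ h => h.1
  have hinj : Function.Injective (wordRoot C x w) := by
    intro j j' h
    by_contra hne
    rcases lt_or_gt_of_ne hne with h' | h'
    · have h1 := hmono _ _ h'
      rw [h] at h1
      exact hirr _ (hw _) h1
    · have h1 := hmono _ _ h'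
      rw [h] at h1
      exact hirr _ (hw _) h1
  have hcard : (Set.range (wordRoot C x w)).ncard = M := by
    rw [← Nat.card_coe_set_eq, Nat.card_range_of_injective hinj, Nat.card_fin, hlen]
  have hrange : Set.range (wordRoot C x w) = R.pos x :=
    Set.eq_of_subset_of_ncard_le (Set.range_subset_iff.mpr hw) (by omega) hposfin
  refine ⟨wordEnd C x w, wordMap C x w, w, hlen, ⟨⟨rfl, rfl⟩, ?_⟩, hw, fun α hα => ?_, hmono⟩
  · refine le_antisymm (le_csInf ⟨_, w, rfl, rfl, rfl⟩ ?_) (Nat.sInf_le ⟨w, rfl, rfl, rfl⟩)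
    rintro _ ⟨v, rfl, hv1, hv2⟩
    have hequiv : wordEquiv C x v = wordEquiv C x w := by
      apply DFunLike.coe_injective
      rw [coe_wordEquiv, coe_wordEquiv, hv2]
    have hinv : R.inversions x v = R.inversions x w := by
      rw [inversions, inversions, hequiv, hv1]
    have h1 := ncard_inversions_le_length (R := R) hfin x v
    rw [hinv, inversions_eq_range hw] at h1
    omega
  · rwa [← hrange] at hα

end Orders

end RootSystem

end Helpers

/-- For a total order `<` on `Δ^X_+` (given by a relation `lt` which is a strict
total order on `Δ^X_+`), the following are equivalent: (1) the order is the one associated with a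
reduced expression of an element of maximal length `M = |Δ^X_+|`; (2) the order is strongly
convex; (3) the order is convex. -/
theorem stmt3 {n : ℕ} (hn : 1 ≤ n) (C : CartanScheme n) (R : RootSystem C)
    (hfin : ∀ z : C.X, (R.Δ z).Finite)
    (x : C.X) (M : ℕ) (hM : (R.pos x).ncard = M)
    (lt : (Fin n → ℤ) → (Fin n → ℤ) → Prop)
    (hirr : ∀ a ∈ R.pos x, ¬ lt a a)
    (htrans : ∀ a ∈ R.pos x, ∀ b ∈ R.pos x, ∀ c ∈ R.pos x, lt a b → lt b c → lt a c)
    (htotal : ∀ a ∈ R.pos x, ∀ b ∈ R.pos x, a ≠ b → lt a b ∨ lt b a) :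
    -- (1): the order comes from a reduced expression of the longest element
    ((∃ (y : C.X) (φ : (Fin n → ℤ) → (Fin n → ℤ)) (w : List (Fin n)),
        w.length = M ∧ IsReduced C x y φ w ∧
        (∀ j : Fin w.length, wordRoot C x w j ∈ R.pos x) ∧
        (∀ α ∈ R.pos x, ∃ j : Fin w.length, wordRoot C x w j = α) ∧
        (∀ j j' : Fin w.length, j < j' → lt (wordRoot C x w j) (wordRoot C x w j'))) ↔
      -- (2): strongly convex
      (∀ (m : ℕ) (γ : Fin (m + 2) → (Fin n → ℤ)),
        (∀ p, γ p ∈ R.pos x) →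
        (∀ p p' : Fin (m + 2), p ≤ p' → γ p = γ p' ∨ lt (γ p) (γ p')) →
        (∑ p, γ p) ∈ R.pos x →
        lt (γ 0) (∑ p, γ p) ∧ lt (∑ p, γ p) (γ (Fin.last (m + 1))))) ∧
    -- (2) ↔ (3): convex
    ((∀ (m : ℕ) (γ : Fin (m + 2) → (Fin n → ℤ)),
        (∀ p, γ p ∈ R.pos x) →
        (∀ p p' : Fin (m + 2), p ≤ p' → γ p = γ p' ∨ lt (γ p) (γ p')) →
        (∑ p, γ p) ∈ R.pos x →
        lt (γ 0) (∑ p, γ p) ∧ lt (∑ p, γ p) (γ (Fin.last (m + 1)))) ↔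
      (∀ a ∈ R.pos x, ∀ b ∈ R.pos x, lt a b → a + b ∈ R.pos x →
        lt a (a + b) ∧ lt (a + b) b)) := by
  have : NeZero n := ⟨by omega⟩
  have h23 := RootSystem.convex_of_stronglyConvex (R := R) (x := x) (lt := lt)
  have h31 := RootSystem.exists_word_of_convex hfin hM hirr htrans htotal
  refine ⟨⟨?_, fun h => h31 (h23 h)⟩, h23, fun h => ?_⟩
  · rintro ⟨y, φ, w, -, -, h1, h2, h3⟩
    exact RootSystem.stronglyConvex_of_word hirr htrans htotal h1 h2 h3
  · obtain ⟨y, φ, w, -, -, h1, h2, h3⟩ := h31 h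
    exact RootSystem.stronglyConvex_of_word hirr htrans htotal h1 h2 h3

end WeylGpd
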